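/- Let Y be an n-dimensional Nöbeling space and let X ⊆ Y be such that Y \ X is a σ-Z-set in Y. Then every subset of Y which is closed in Y and disjoint from X is a Z-set in Y. -/

import Mathlib

open Set Topology

noncomputable section

namespace NobelingPaper

/-- Two maps into `Y` are `𝒰`-close: for every point some element of `𝒰` contains
both of its images. -/
def UClose {A Y : Type*} (𝒰 : Set (Set Y)) (f g : A → Y) : Prop :=
  ∀ a : A, ∃ u ∈ 𝒰, f a ∈ u ∧ g a ∈ u

/-- `𝒰` is a cover of the whole space by open sets. -/
def IsOpenCover {Y : Type*} [TopologicalSpace Y] (𝒰 : Set (Set Y)) : Prop :=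
  (∀ u ∈ 𝒰, IsOpen u) ∧ ⋃₀ 𝒰 = univ

/-- Covering dimension at most `n`: every open cover admits an open refinement of
order at most `n + 1`. -/
def CovDimLE (X : Type*) [TopologicalSpace X] (n : ℕ) : Prop :=
  ∀ 𝒰 : Set (Set X), IsOpenCover 𝒰 →
    ∃ 𝒱 : Set (Set X), IsOpenCover 𝒱 ∧ (∀ v ∈ 𝒱, ∃ u ∈ 𝒰, v ⊆ u) ∧
      ∀ x : X, {v ∈ 𝒱 | x ∈ v}.Finite ∧ {v ∈ 𝒱 | x ∈ v}.ncard ≤ n + 1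

/-- Covering dimension equal to `n`. -/
def CovDimEq (X : Type*) [TopologicalSpace X] (n : ℕ) : Prop :=
  CovDimLE X n ∧ ∀ m : ℕ, CovDimLE X m → n ≤ m

/-- `X` is an absolute extensor in dimension `n`: every map into `X` from a closed
subset of a (separable metrizable) space of covering dimension at most `n` extends
over the whole space. -/
def IsAbsExtensorInDim (n : ℕ) (X : Type*) [TopologicalSpace X] : Prop :=
  ∀ (Y : Type) [TopologicalSpace Y] [TopologicalSpace.SeparableSpace Y]
    [TopologicalSpace.MetrizableSpace Y], CovDimLE Y n →
    ∀ A : Set Y, IsClosed A → ∀ f : C(A, X), ∃ g : C(Y, X), ∀ a : A, g ↑a = f a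

/-- `X` is an `n`-dimensional Nöbeling space: a complete separable metrizable
(i.e. Polish) space of covering dimension `n` which is an absolute extensor in
dimension `n` and in which every map from a complete (separable metrizable) space of
dimension at most `n` can be arbitrarily closely approximated by a closed embedding. -/
def IsNobeling (n : ℕ) (X : Type*) [TopologicalSpace X] : Prop :=
  PolishSpace X ∧ CovDimEq X n ∧ IsAbsExtensorInDim n X ∧
    ∀ (Y : Type) [TopologicalSpace Y] [PolishSpace Y], CovDimLE Y n →
      ∀ f : C(Y, X), ∀ 𝒰 : Set (Set X), IsOpenCover 𝒰 →
        ∃ g : C(Y, X), IsClosedEmbedding ⇑g ∧ UClose 𝒰 ⇑g ⇑f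

/-- `A` is a `Z`-set in `X`. -/
def IsZSet {X : Type*} [TopologicalSpace X] (A : Set X) : Prop :=
  IsClosed A ∧ ∀ 𝒰 : Set (Set X), IsOpenCover 𝒰 →
    ∃ f : C(X, X), UClose 𝒰 ⇑f id ∧ range ⇑f ∩ A = ∅

/-- A `σ-Z`-set is a countable union of `Z`-sets. -/
def IsSigmaZSet {X : Type*} [TopologicalSpace X] (A : Set X) : Prop :=
  ∃ F : ℕ → Set X, (∀ i, IsZSet (F i)) ∧ A = ⋃ i, F i

/-- A `Z`-embedding is a closed embedding whose image is a `Z`-set. -/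
def IsZEmbedding {X Y : Type*} [TopologicalSpace X] [TopologicalSpace Y]
    (f : X → Y) : Prop :=
  IsClosedEmbedding f ∧ IsZSet (range f)

/-- The `k`-dimensional sphere. -/
abbrev Sph (k : ℕ) : Type := ↥(Metric.sphere (0 : EuclideanSpace ℝ (Fin (k + 1))) 1)

/-- The inclusion of `V` into `U` as a continuous map. -/
def inclCM {X : Type*} [TopologicalSpace X] {V U : Set X} (h : V ⊆ U) : C(V, U) :=
  ⟨Set.inclusion h, continuous_inclusion h⟩

/-- The inclusion `V ⊆ U` induces the zero homomorphism of homotopy groups in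
dimensions `≤ n − 1` (i.e. `< n`): every map of a sphere of dimension `< n` into `V`
becomes nullhomotopic in `U`. -/
def InclusionNullInDimLT {X : Type*} [TopologicalSpace X] (n : ℕ) (V U : Set X) : Prop :=
  ∃ h : V ⊆ U, ∀ k, k < n → ∀ f : C(Sph k, V), ((inclCM h).comp f).Nullhomotopic

/-- `f : X → Y` is a `UV^{n−1}`-map. -/
def IsUVMap (n : ℕ) {X Y : Type*} [TopologicalSpace X] [TopologicalSpace Y]
    (f : X → Y) : Prop :=
  Continuous f ∧ Dense (range f) ∧
    ∀ y : Y, ∀ U : Set Y, IsOpen U → y ∈ U →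
      ∃ V : Set Y, IsOpen V ∧ y ∈ V ∧ V ⊆ U ∧
        InclusionNullInDimLT n (f ⁻¹' V) (f ⁻¹' U)

/-- `X` is `(n−1)`-connected: nonempty, and every map of a sphere of dimension `< n`
into `X` is nullhomotopic. -/
def IsConnectedBelow (X : Type*) [TopologicalSpace X] (n : ℕ) : Prop :=
  Nonempty X ∧ ∀ k, k < n → ∀ f : C(Sph k, X), f.Nullhomotopic

/-! ### Triangulated spaces, PL and rational notions -/

/-- A fixed separable metrizable ambient topological vector space in which all our
(locally finite, hence finite-dimensional) simplicial complexes live. -/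
abbrev Amb : Type := ℕ → ℝ

/-- Simplicial complexes in the ambient space. -/
abbrev SC : Type := Geometry.SimplicialComplex ℝ Amb

/-- The complex `K` has dimension at most `k`. -/
def DimLE (K : SC) (k : ℕ) : Prop := ∀ s ∈ K.faces, s.card ≤ k + 1

/-- The complex `K` is purely `m`-dimensional. -/
def PureDim (K : SC) (m : ℕ) : Prop :=
  (∀ s ∈ K.faces, s.card ≤ m + 1) ∧
    ∀ s ∈ K.faces, ∃ t ∈ K.faces, s ⊆ t ∧ t.card = m + 1

/-- The complex `K` is locally finite. -/
def LocFinite (K : SC) : Prop :=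
  ∀ x ∈ K.space, ∃ U : Set Amb, IsOpen U ∧ x ∈ U ∧
    {s : Finset Amb | s ∈ K.faces ∧ (convexHull ℝ (s : Set Amb) ∩ U).Nonempty}.Finite

/-- `K'` is a subdivision of `K`. -/
def Subdivides (K' K : SC) : Prop :=
  K'.space = K.space ∧
    ∀ s ∈ K'.faces, ∃ t ∈ K.faces, convexHull ℝ (s : Set Amb) ⊆ convexHull ℝ (t : Set Amb)

/-- `f` is a PL-map on the complex `K`: affine on each simplex of some
subdivision of `K`. -/
def IsPLMap (K : SC) (f : Amb → Amb) : Prop :=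
  ∃ K' : SC, Subdivides K' K ∧
    ∀ s ∈ K'.faces, ∃ g : Amb →ᵃ[ℝ] Amb, EqOn f ⇑g (convexHull ℝ (s : Set Amb))

/-- A point with rational barycentric coordinates with respect to the
triangulation `K`. -/
def IsRationalPoint (K : SC) (x : Amb) : Prop :=
  ∃ s ∈ K.faces, ∃ w : Amb → ℚ, (∀ v ∈ s, 0 ≤ w v) ∧
    (∑ v ∈ s, (w v : ℝ)) = 1 ∧ (∑ v ∈ s, (w v : ℝ) • v) = x

/-- A rational map from the triangulated space `K` into the triangulated space `M`:
a (continuous) PL-map sending points with rational barycentric coordinates to points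
with rational barycentric coordinates. -/
def IsRationalMapInto (K M : SC) (f : Amb → Amb) : Prop :=
  IsPLMap K f ∧ ContinuousOn f K.space ∧ MapsTo f K.space M.space ∧
    ∀ x, IsRationalPoint K x → IsRationalPoint M (f x)

/-- `A` is the underlying set of a triangulated space of dimension `≤ k`
rationally embedded in `M`. -/
def IsRationallyEmbedded (M : SC) (k : ℕ) (A : Set Amb) : Prop :=
  ∃ (K : SC) (f : Amb → Amb), DimLE K k ∧ IsRationalMapInto K M f ∧
    InjOn f K.space ∧ A = f '' K.space

/-- `M(k)`: the complement in `M` of the union of all triangulated spaces of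
dimension `≤ k` rationally embedded in `M`. -/
def MkSet (M : SC) (k : ℕ) : Set Amb :=
  M.space \ ⋃₀ {A : Set Amb | IsRationallyEmbedded M k A}

/-- The halfspace model for manifolds with boundary. -/
def HalfSpace (m : ℕ) : Set (EuclideanSpace ℝ (Fin m)) :=
  {y | ∀ i : Fin m, (i : ℕ) = 0 → 0 ≤ y i}

/-- `X` is an `m`-dimensional topological manifold with (possibly empty) boundary. -/
def IsTopManifoldWithBoundary (X : Type*) [TopologicalSpace X] (m : ℕ) : Prop :=
  ∀ x : X, ∃ U : Set X, IsOpen U ∧ x ∈ U ∧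
    ∃ V : Set (HalfSpace m), IsOpen V ∧ Nonempty (↥U ≃ₜ ↥V)

/-- `M` is a triangulated (combinatorial) `m`-dimensional manifold with possibly
empty boundary: a locally finite purely `m`-dimensional complex whose underlying
space is an `m`-manifold with boundary. -/
def IsTriManifold (M : SC) (m : ℕ) : Prop :=
  LocFinite M ∧ PureDim M m ∧ IsTopManifoldWithBoundary (↥M.space) m

/-- The manifold interior `Int M` of the triangulated manifold `M`. -/
def ManifoldInterior (M : SC) (m : ℕ) : Set Amb :=
  {x | ∃ hx : x ∈ M.space, ∃ U : Set (↥M.space), IsOpen U ∧ (⟨x, hx⟩ : ↥M.space) ∈ U ∧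
      ∃ V : Set (EuclideanSpace ℝ (Fin m)), IsOpen V ∧ Nonempty (↥U ≃ₜ ↥V)}

/-- `X` is (homeomorphic to) an `n`-dimensional Nöbeling space modeled on a
triangulated manifold: `X ≃ₜ M(k)` where `M` is an `(n−1)`-connected triangulated
`m`-dimensional manifold, `m ≥ 2n+1` and `k = m − n − 1`. -/
def IsModeledNobeling (n : ℕ) (X : Type*) [TopologicalSpace X] : Prop :=
  ∃ (M : SC) (m k : ℕ), m = n + k + 1 ∧ 2 * n + 1 ≤ m ∧ IsTriManifold M m ∧
    IsConnectedBelow (↥M.space) n ∧ Nonempty (X ≃ₜ ↥(MkSet M k))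

/-- `x` is a regular point of `f`: the preimages of the open sets around `f x`
form a neighborhood base at `x`. -/
def IsRegularPoint {X Y : Type*} [TopologicalSpace X] [TopologicalSpace Y]
    (f : X → Y) (x : X) : Prop :=
  (∀ U : Set Y, IsOpen U → f x ∈ U → f ⁻¹' U ∈ nhds x) ∧
    ∀ W ∈ nhds x, ∃ U : Set Y, IsOpen U ∧ f x ∈ U ∧ f ⁻¹' U ⊆ W

/-- `f` is PL on the set `A`: `A` carries a triangulation on each of whose
simplexes `f` is affine. -/
def IsPLOn (A : Set Amb) (f : Amb → Amb) : Prop :=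
  ∃ K : SC, K.space = A ∧
    ∀ s ∈ K.faces, ∃ g : Amb →ᵃ[ℝ] Amb, EqOn f ⇑g (convexHull ℝ (s : Set Amb))

theorem swell {E : Type*} [TopologicalSpace E] [TopologicalSpace.MetrizableSpace E]
    {ι : Type*} (A : Set E) (V : ι → Set E) (hV : ∀ i, IsOpen (V i)) :
    ∃ V' : ι → Set E, (∀ i, IsOpen (V' i)) ∧ (∀ i, V' i ⊆ V i) ∧ (∀ i, A ∩ V i ⊆ V' i) ∧
      ∀ x : E, ∀ I : Finset ι, I.Nonempty → (∀ i ∈ I, x ∈ V' i) → ∃ a ∈ A, ∀ i ∈ I, a ∈ V i := by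
  let := TopologicalSpace.metrizableSpaceMetric E
  refine ⟨fun i => {x | Metric.infEDist x (A ∩ V i) < Metric.infEDist x (A \ V i)} ∩ V i,
    fun i => (isOpen_lt Metric.continuous_infEDist Metric.continuous_infEDist).inter (hV i),
    fun i => inter_subset_right, ?_, ?_⟩
  · rintro i x ⟨hxA, hxV⟩
    refine ⟨?_, hxV⟩
    show Metric.infEDist x (A ∩ V i) < Metric.infEDist x (A \ V i)
    rw [Metric.infEDist_zero_of_mem (show x ∈ A ∩ V i from ⟨hxA, hxV⟩), pos_iff_ne_zero]
    intro h
    rw [← Metric.mem_closure_iff_infEDist_zero, mem_closure_iff] at h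
    obtain ⟨y, hy1, hy2⟩ := h _ (hV i) hxV
    exact hy2.2 hy1
  · intro x I hI hx
    have : ∀ i ∈ I, ∃ a ∈ A ∩ V i, edist x a < Metric.infEDist x (A \ V i) := by
      intro i hi
      exact Metric.infEDist_lt_iff.1 (hx i hi).1
    have hneE : Nonempty E := ⟨x⟩
    choose! a ha hlt using this
    obtain ⟨k, hk, hmin⟩ := I.exists_min_image (fun i => edist x (a i)) hI
    refine ⟨a k, (ha k hk).1, fun i hi => ?_⟩
    by_contra hcon
    have h1 : Metric.infEDist x (A \ V i) ≤ edist x (a k) :=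
      Metric.infEDist_le_edist_of_mem ⟨(ha k hk).1, hcon⟩
    exact absurd (h1.trans (hmin i hi)) (not_le.2 (hlt i hi))

/-- Ambient version of covering dimension. -/
def CovOn {E : Type*} [TopologicalSpace E] (A : Set E) (n : ℕ) : Prop :=
  ∀ (ι : Type) (U : ι → Set E), (∀ i, IsOpen (U i)) → A ⊆ ⋃ i, U i →
    ∃ V : ι → Set E, (∀ i, IsOpen (V i)) ∧ (∀ i, V i ⊆ U i) ∧ A ⊆ ⋃ i, V i ∧
      ∀ x ∈ A, ∀ I : Finset ι, (∀ i ∈ I, x ∈ V i) → I.card ≤ n + 1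

theorem CovOn.mono {E : Type*} [TopologicalSpace E] {A : Set E} {m n : ℕ} (h : CovOn A m)
    (hmn : m ≤ n) : CovOn A n := by
  intro ι U hU hA
  obtain ⟨V, h1, h2, h3, h4⟩ := h ι U hU hA
  exact ⟨V, h1, h2, h3, fun x hx I hI => (h4 x hx I hI).trans (by omega)⟩

theorem CovOn.empty {E : Type*} [TopologicalSpace E] (n : ℕ) : CovOn (∅ : Set E) n := by
  intro ι U hU hA
  exact ⟨U, hU, fun _ => subset_rfl, hA, fun x hx => hx.elim⟩

theorem CovOn.inter_closed {E : Type*} [TopologicalSpace E] {A : Set E} {n : ℕ} (h : CovOn A n)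
    {N : Set E} (hN : IsClosed N) : CovOn (A ∩ N) n := by
  intro ι U hU hA
  obtain ⟨V, h1, h2, h3, h4⟩ := h (Option ι) (fun o => o.elim Nᶜ U)
    (by rintro (_ | i); exacts [hN.isOpen_compl, hU i])
    (by
      intro x hx
      by_cases hxN : x ∈ N
      · obtain ⟨i, hi⟩ := mem_iUnion.1 (hA ⟨hx, hxN⟩)
        exact mem_iUnion.2 ⟨some i, hi⟩
      · exact mem_iUnion.2 ⟨none, hxN⟩)
  refine ⟨fun i => V (some i), fun i => h1 _, fun i => h2 (some i), ?_, ?_⟩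
  · rintro x ⟨hx, hxN⟩
    obtain ⟨(_ | i), hi⟩ := mem_iUnion.1 (h3 hx)
    · exact absurd hxN (h2 none hi)
    · exact mem_iUnion.2 ⟨i, hi⟩
  · rintro x ⟨hx, hxN⟩ I hI
    have := h4 x hx (I.map Function.Embedding.some) (by simpa using hI)
    simpa using this

theorem CovOn.swelled {E : Type*} [TopologicalSpace E] [TopologicalSpace.MetrizableSpace E]
    {A : Set E} {n : ℕ} (h : CovOn A n)
    {ι : Type} (U : ι → Set E) (hU : ∀ i, IsOpen (U i)) (hA : A ⊆ ⋃ i, U i) :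
    ∃ V : ι → Set E, (∀ i, IsOpen (V i)) ∧ (∀ i, V i ⊆ U i) ∧ A ⊆ ⋃ i, V i ∧
      ∀ x, ∀ I : Finset ι, (∀ i ∈ I, x ∈ V i) → I.card ≤ n + 1 := by
  obtain ⟨V, h1, h2, h3, h4⟩ := h ι U hU hA
  obtain ⟨V', g1, g2, g3, g4⟩ := swell A V h1
  refine ⟨V', g1, fun i => (g2 i).trans (h2 i), ?_, ?_⟩
  · intro x hx
    obtain ⟨i, hi⟩ := mem_iUnion.1 (h3 hx)
    exact mem_iUnion.2 ⟨i, g3 i ⟨hx, hi⟩⟩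
  · intro x I hI
    rcases I.eq_empty_or_nonempty with rfl | hne
    · simp
    · obtain ⟨a, ha, haI⟩ := g4 x I hne hI
      exact h4 a ha I haI

/-- Sum lemma. -/
theorem CovOn.sum_closed {E : Type*} [TopologicalSpace E] [TopologicalSpace.MetrizableSpace E]
    {X c : Set E} {n : ℕ} (hc : IsClosed c) (h : CovOn (X ∩ c) n)
    (hN : ∀ N : Set E, IsClosed N → X ∩ N ∩ c = ∅ → CovOn (X ∩ N) n) : CovOn X n := by
  classical
  let := TopologicalSpace.metrizableSpaceMetric E
  intro ι U hU hX
  obtain ⟨V, v1, v2, v3, v4⟩ := h.swelled U hU (inter_subset_left.trans hX)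
  set W : Set E := ⋃ i, V i with hW
  have hWo : IsOpen W := isOpen_iUnion v1
  set W1 : Set E := {x | Metric.infEDist x (X ∩ c) < Metric.infEDist x (X \ W)} with hW1
  set W2 : Set E := {x | Metric.infEDist x (X \ W) < Metric.infEDist x (X ∩ c)} with hW2
  have o1 : IsOpen W1 := isOpen_lt Metric.continuous_infEDist Metric.continuous_infEDist
  have o2 : IsOpen W2 := isOpen_lt Metric.continuous_infEDist Metric.continuous_infEDist
  have a1 : X ∩ c ⊆ W1 := by
    intro x hx
    show Metric.infEDist x (X ∩ c) < Metric.infEDist x (X \ W)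
    rw [Metric.infEDist_zero_of_mem hx, pos_iff_ne_zero]
    intro h
    rw [← Metric.mem_closure_iff_infEDist_zero, mem_closure_iff] at h
    obtain ⟨y, hy1, hy2⟩ := h _ hWo (v3 hx)
    exact hy2.2 hy1
  have a2 : X \ W ⊆ W2 := by
    intro x hx
    show Metric.infEDist x (X \ W) < Metric.infEDist x (X ∩ c)
    rw [Metric.infEDist_zero_of_mem hx, pos_iff_ne_zero]
    intro h
    rw [← Metric.mem_closure_iff_infEDist_zero] at h
    have : x ∈ c := closure_minimal inter_subset_right hc h
    exact hx.2 (v3 ⟨hx.1, this⟩)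
  have a3 : ∀ x, x ∈ W1 → x ∉ W2 := by
    intro x h1 h2
    rw [hW1, mem_ofPred_eq] at h1
    rw [hW2, mem_ofPred_eq] at h2
    exact lt_asymm h1 h2
  obtain ⟨M, m1, m2, m3, m4⟩ := hN W1ᶜ o1.isClosed_compl
    (by
      ext x
      simp only [mem_inter_iff, mem_compl_iff, mem_empty_iff_false, iff_false]
      rintro ⟨⟨h1, h2⟩, h3⟩
      exact h2 (a1 ⟨h1, h3⟩)) (ι ⊕ ι) (Sum.elim V (fun i => U i ∩ W2))
    (by rintro (i | i); exacts [v1 i, (hU i).inter o2])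
    (by
      rintro x ⟨hx, hx1⟩
      by_cases hxW : x ∈ W
      · obtain ⟨i, hi⟩ := mem_iUnion.1 hxW
        exact mem_iUnion.2 ⟨Sum.inl i, hi⟩
      · obtain ⟨i, hi⟩ := mem_iUnion.1 (hX hx)
        exact mem_iUnion.2 ⟨Sum.inr i, hi, a2 ⟨hx, hxW⟩⟩)
  refine ⟨fun i => M (Sum.inl i) ∪ M (Sum.inr i) ∪ (V i ∩ W1),
    fun i => ((m1 _).union (m1 _)).union ((v1 i).inter o1), ?_, ?_, ?_⟩
  · rintro i x ((hx | hx) | hx)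
    · exact v2 i (m2 (Sum.inl i) hx)
    · exact (m2 (Sum.inr i) hx).1
    · exact v2 i hx.1
  · intro x hx
    by_cases hx1 : x ∈ W1
    · by_cases hxW : x ∈ W
      · obtain ⟨i, hi⟩ := mem_iUnion.1 hxW
        exact mem_iUnion.2 ⟨i, Or.inr ⟨hi, hx1⟩⟩
      · exact absurd (a2 ⟨hx, hxW⟩) (a3 x hx1)
    · obtain ⟨i | i, hi⟩ := mem_iUnion.1 (m3 ⟨hx, hx1⟩)
      · exact mem_iUnion.2 ⟨i, Or.inl (Or.inl hi)⟩
      · exact mem_iUnion.2 ⟨i, Or.inl (Or.inr hi)⟩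
  · intro x hx I hI
    by_cases hx1 : x ∈ W1
    · refine v4 x I fun i hi => ?_
      rcases hI i hi with (h | h) | h
      · exact m2 (Sum.inl i) h
      · exact absurd (m2 (Sum.inr i) h).2 (a3 x hx1)
      · exact h.1
    · have key : ∀ i ∈ I, ∃ k : ι ⊕ ι, x ∈ M k ∧ Sum.elim id id k = i := by
        intro i hi
        rcases hI i hi with (h | h) | h
        · exact ⟨Sum.inl i, h, rfl⟩
        · exact ⟨Sum.inr i, h, rfl⟩
        · exact absurd h.2 hx1
      choose! k hk1 hk2 using key
      have hinj : Set.InjOn k I := by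
        intro i hi j hj hij
        rw [← hk2 i hi, ← hk2 j hj, hij]
      rw [← Finset.card_image_of_injOn hinj]
      refine m4 x ⟨hx, hx1⟩ _ ?_
      intro y hy
      obtain ⟨i, hi, rfl⟩ := Finset.mem_image.1 hy
      exact hk1 i hi

theorem CovOn.disjoint_sum {E : Type*} [TopologicalSpace E] {κ : Type*}
    {X : Set E} {n : ℕ} (G : κ → Set E) (hG : ∀ k, IsOpen (G k)) (hX : X ⊆ ⋃ k, G k)
    (hd : ∀ x ∈ X, ∀ k l, x ∈ G k → x ∈ G l → k = l)
    (h : ∀ k, CovOn (X ∩ G k) n) : CovOn X n := by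
  intro ι U hU hXU
  choose V v1 v2 v3 v4 using fun k => h k ι U hU (inter_subset_left.trans hXU)
  refine ⟨fun i => ⋃ k, V k i ∩ G k, fun i => isOpen_iUnion fun k => (v1 k i).inter (hG k),
    fun i => iUnion_subset fun k => inter_subset_left.trans (v2 k i), ?_, ?_⟩
  · intro x hx
    obtain ⟨k, hk⟩ := mem_iUnion.1 (hX hx)
    obtain ⟨i, hi⟩ := mem_iUnion.1 (v3 k ⟨hx, hk⟩)
    exact mem_iUnion.2 ⟨i, mem_iUnion.2 ⟨k, hi, hk⟩⟩
  · intro x hx I hI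
    obtain ⟨k, hk⟩ := mem_iUnion.1 (hX hx)
    refine v4 k x ⟨hx, hk⟩ I fun i hi => ?_
    obtain ⟨l, hl1, hl2⟩ := mem_iUnion.1 (hI i hi)
    rw [hd x hx k l hk hl2]
    exact hl1

theorem CovOn.of_injOn {E F : Type*} [TopologicalSpace E] [TopologicalSpace F] [T2Space F]
    {M : Set E} {n : ℕ} (hM : IsCompact M) (ψ : E → F) (hψ : Continuous ψ) (hinj : InjOn ψ M)
    (h : CovOn (ψ '' M) n) : CovOn M n := by
  intro ι U hU hMU
  have key : ∀ x ∈ M, ∀ i, ψ x ∈ (ψ '' (M \ U i))ᶜ ↔ x ∈ U i := by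
    intro x hx i
    constructor
    · intro h
      by_contra hc
      exact h ⟨x, ⟨hx, hc⟩, rfl⟩
    · rintro h ⟨y, ⟨hy, hyU⟩, hxy⟩
      rw [hinj hy hx hxy] at hyU
      exact hyU h
  obtain ⟨V, v1, v2, v3, v4⟩ := h ι (fun i => (ψ '' (M \ U i))ᶜ)
    (fun i => ((hM.diff (hU i)).image hψ).isClosed.isOpen_compl)
    (by
      rintro _ ⟨x, hx, rfl⟩
      obtain ⟨i, hi⟩ := mem_iUnion.1 (hMU hx)
      exact mem_iUnion.2 ⟨i, (key x hx i).2 hi⟩)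
  refine ⟨fun i => ψ ⁻¹' V i ∩ U i, fun i => ((v1 i).preimage hψ).inter (hU i),
    fun i => inter_subset_right, ?_, ?_⟩
  · intro x hx
    obtain ⟨i, hi⟩ := mem_iUnion.1 (v3 (mem_image_of_mem ψ hx))
    exact mem_iUnion.2 ⟨i, hi, (key x hx i).1 (v2 i hi)⟩
  · intro x hx I hI
    exact v4 _ (mem_image_of_mem ψ hx) I fun i hi => (hI i hi).1

theorem CovOn.range_of_covDimLE {Y E : Type} [TopologicalSpace Y] [TopologicalSpace E] {n : ℕ}
    (hY : CovDimLE Y n) (e : Y → E) (he : IsInducing e) : CovOn (range e) n := by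
  intro ι U hU hc
  obtain ⟨𝒱, ⟨o1, o2⟩, r, ord⟩ := hY (range fun i => e ⁻¹' U i)
    ⟨by rintro _ ⟨i, rfl⟩; exact (hU i).preimage he.continuous, by
      refine eq_univ_of_forall fun y => ?_
      obtain ⟨i, hi⟩ := mem_iUnion.1 (hc (mem_range_self y))
      exact ⟨_, ⟨i, rfl⟩, hi⟩⟩
  have r' : ∀ v ∈ 𝒱, ∃ i, v ⊆ e ⁻¹' U i := by
    intro v hv
    obtain ⟨_, ⟨i, rfl⟩, h⟩ := r v hv
    exact ⟨i, h⟩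
  by_cases hι : Nonempty ι
  swap
  · refine ⟨U, hU, fun _ => subset_rfl, hc, fun x hx I _ => ?_⟩
    obtain ⟨i, _⟩ := mem_iUnion.1 (hc hx)
    exact absurd ⟨i⟩ hι
  choose! φ hφ using r'
  have : ∀ i, ∃ O : Set E, IsOpen O ∧ e ⁻¹' O = ⋃₀ {v ∈ 𝒱 | φ v = i} := fun i =>
    he.isOpen_iff.1 (isOpen_sUnion fun v hv => o1 v hv.1)
  choose O hO hOe using this
  refine ⟨fun i => O i ∩ U i, fun i => (hO i).inter (hU i), fun i => inter_subset_right, ?_, ?_⟩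
  · rintro _ ⟨y, rfl⟩
    obtain ⟨v, hv, hyv⟩ := (o2.symm ▸ mem_univ y : y ∈ ⋃₀ 𝒱)
    refine mem_iUnion.2 ⟨φ v, ?_, hφ v hv hyv⟩
    have : y ∈ e ⁻¹' O (φ v) := by rw [hOe]; exact ⟨v, ⟨hv, rfl⟩, hyv⟩
    exact this
  · rintro _ ⟨y, rfl⟩ I hI
    have : ∀ i ∈ I, ∃ v ∈ 𝒱, φ v = i ∧ y ∈ v := by
      intro i hi
      have : y ∈ e ⁻¹' O i := (hI i hi).1
      rw [hOe] at this
      obtain ⟨v, ⟨hv, hv2⟩, hy⟩ := this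
      exact ⟨v, hv, hv2, hy⟩
    choose! k hk1 hk2 hk3 using this
    have hinj : Set.InjOn k I := by
      intro i hi j hj hij
      rw [← hk2 i hi, ← hk2 j hj, hij]
    obtain ⟨hf, hcard⟩ := ord y
    refine le_trans ?_ hcard
    rw [← Set.ncard_coe_finset]
    exact Set.ncard_le_ncard_of_injOn k (fun i hi => ⟨hk1 i hi, hk3 i hi⟩) hinj hf

theorem CovOn.covDimLE {E : Type} [TopologicalSpace E] {A : Set E} {n : ℕ}
    (h : CovOn A n) : CovDimLE A n := by
  classical
  rintro 𝒰 ⟨u1, u2⟩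
  have : ∀ u : 𝒰, ∃ O : Set E, IsOpen O ∧ Subtype.val ⁻¹' O = (u : Set A) := fun u =>
    isOpen_induced_iff.1 (u1 u u.2)
  choose O hO hOe using this
  obtain ⟨V, v1, v2, v3, v4⟩ := h 𝒰 O hO (by
    intro x hx
    obtain ⟨u, hu, hxu⟩ := (u2.symm ▸ mem_univ _ : (⟨x, hx⟩ : A) ∈ ⋃₀ 𝒰)
    refine mem_iUnion.2 ⟨⟨u, hu⟩, ?_⟩
    have : (⟨x, hx⟩ : A) ∈ Subtype.val ⁻¹' O ⟨u, hu⟩ := by rw [hOe]; exact hxu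
    exact this)
  refine ⟨range fun u => (Subtype.val ⁻¹' V u : Set A), ⟨?_, ?_⟩, ?_, ?_⟩
  · rintro _ ⟨u, rfl⟩
    exact (v1 u).preimage continuous_subtype_val
  · refine eq_univ_of_forall fun x => ?_
    obtain ⟨i, hi⟩ := mem_iUnion.1 (v3 x.2)
    exact ⟨_, ⟨i, rfl⟩, hi⟩
  · rintro _ ⟨u, rfl⟩
    refine ⟨u, u.2, ?_⟩
    conv_rhs => rw [← hOe u]
    exact preimage_mono (v2 u)
  · intro x
    have hfin : {u : 𝒰 | (x : E) ∈ V u}.Finite := by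
      by_contra hinf
      obtain ⟨t, ht, hc⟩ := Set.Infinite.exists_subset_card_eq hinf (n + 2)
      have := v4 x x.2 t (fun i hi => ht hi)
      omega
    have hsub : {v ∈ range (fun u => (Subtype.val ⁻¹' V u : Set A)) | x ∈ v} ⊆
        (fun u => (Subtype.val ⁻¹' V u : Set A)) '' {u : 𝒰 | (x : E) ∈ V u} := by
      rintro _ ⟨⟨u, rfl⟩, hx⟩
      exact ⟨u, hx, rfl⟩
    refine ⟨(hfin.image _).subset hsub, ?_⟩
    refine (Set.ncard_le_ncard hsub (hfin.image _)).trans ((Set.ncard_image_le hfin).trans ?_)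
    rw [Set.ncard_eq_toFinset_card _ hfin]
    exact v4 x x.2 _ (by simp)

/-- The grid label: even integers are fixed, other reals go to the nearest odd integer. -/
def glab (y : ℝ) : ℤ := ⌊y / 2⌋ + ⌈y / 2⌉

theorem glab_lt (y : ℝ) : |y - glab y| < 1 := by
  unfold glab
  have h1 := Int.floor_le (y / 2)
  have h2 := Int.lt_floor_add_one (y / 2)
  have h3 := Int.le_ceil (y / 2)
  have h4 := Int.ceil_lt_add_one (y / 2)
  push_cast
  rw [abs_lt]; constructor <;> linarith

theorem glab_odd_of {y : ℝ} {a : ℤ} (ha : Odd a) (h : |y - a| < 1) : glab y = a := by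
  obtain ⟨k, rfl⟩ := ha
  push_cast at h
  rw [abs_lt] at h
  have h1 : ⌊y / 2⌋ = k := by rw [Int.floor_eq_iff]; constructor <;> linarith
  have h2 : ⌈y / 2⌉ = k + 1 := by rw [Int.ceil_eq_iff]; push_cast; constructor <;> linarith
  unfold glab; rw [h1, h2]; ring

theorem glab_even_of {y : ℝ} {a : ℤ} (ha : ¬ Odd a) (hy : ¬ Odd (glab y)) (h : |y - a| < 1) :
    glab y = a := by
  have h2 := glab_lt y
  rw [Int.not_odd_iff_even] at ha hy
  obtain ⟨k, hk⟩ := ha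
  obtain ⟨l, hl⟩ := hy
  have : |((glab y - a : ℤ) : ℝ)| < 2 := by
    push_cast
    rw [abs_lt] at *
    constructor <;> linarith
  have h3 : |glab y - a| < 2 := by exact_mod_cast this
  rw [abs_lt] at h3
  omega

theorem CovOn.compact_pi {κ : Type} [Fintype κ] {X : Set (κ → ℝ)} (hX : IsCompact X) :
    CovOn X (Fintype.card κ) := by
  classical
  intro ι U hU hXU
  obtain ⟨δ, hδ, hleb⟩ := lebesgue_number_lemma_of_metric hX hU hXU
  obtain ⟨N, hN⟩ := exists_nat_one_div_lt hδ
  set c : ℝ := 2 * (N + 1) with hc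
  have hNp : (0 : ℝ) < N + 1 := by positivity
  have hcp : 0 < c := by positivity
  let lab : (κ → ℝ) → (κ → ℤ) := fun x v => glab (c * x v)
  let par : (κ → ℤ) → Finset κ := fun a => Finset.univ.filter fun v => Odd (a v)
  have hi : ∀ a : lab '' X, ∃ i, ∀ x ∈ X, lab x = a → x ∈ U i := by
    rintro ⟨_, x, hx, rfl⟩
    obtain ⟨i, hi⟩ := hleb x hx
    refine ⟨i, fun x' hx' hl => hi ?_⟩
    rw [Metric.mem_ball, dist_pi_lt_iff hδ]
    intro v
    have e : glab (c * x' v) = glab (c * x v) := congrFun hl v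
    have h1 := glab_lt (c * x' v)
    have h2 := glab_lt (c * x v)
    rw [e] at h1
    refine lt_trans ?_ hN
    rw [Real.dist_eq, lt_div_iff₀ hNp, ← abs_of_pos hNp, ← abs_mul]
    rw [abs_lt] at *
    constructor <;> nlinarith
  choose i hi using hi
  let O : (lab '' X) → Set (κ → ℝ) := fun a => {x | ∀ v, |c * x v - (a : κ → ℤ) v| < 1} ∩ U (i a)
  have hO : ∀ a, IsOpen (O a) := by
    intro a
    refine IsOpen.inter ?_ (hU _)
    have : {x : κ → ℝ | ∀ v, |c * x v - (a : κ → ℤ) v| < 1}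
        = ⋂ v, {x : κ → ℝ | |c * x v - (a : κ → ℤ) v| < 1} := by ext; simp
    rw [this]
    exact isOpen_iInter_of_finite fun v => isOpen_lt (by fun_prop) continuous_const
  have hsw : ∀ l : ℕ, ∃ V' : {a : lab '' X // (par a).card = l} → Set (κ → ℝ),
      (∀ a, IsOpen (V' a)) ∧ (∀ a, V' a ⊆ O a) ∧
      (∀ a : {a : lab '' X // (par a).card = l},
        {x ∈ X | (par (lab x)).card = l} ∩ O a ⊆ V' a) ∧
      ∀ x, ∀ a b, x ∈ V' a → x ∈ V' b → a = b := by
    intro l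
    obtain ⟨V', g1, g2, g3, g4⟩ := swell {x ∈ X | (par (lab x)).card = l}
      (fun a : {a : lab '' X // (par a).card = l} => O a) (fun a => hO a)
    refine ⟨V', g1, g2, g3, fun x a b ha hb => ?_⟩
    obtain ⟨y, hy, hyO⟩ := g4 x {a, b} (by simp) (by simp [ha, hb])
    have key : ∀ a : {a : lab '' X // (par a).card = l}, y ∈ O a → lab y = a := by
      rintro a ⟨hya, -⟩
      have hsub : par a ⊆ par (lab y) := by
        intro v hv
        have hv' : Odd ((a : κ → ℤ) v) := (Finset.mem_filter.1 hv).2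
        refine Finset.mem_filter.2 ⟨Finset.mem_univ _, ?_⟩
        have : glab (c * y v) = (a : κ → ℤ) v := glab_odd_of hv' (hya v)
        show Odd (glab (c * y v))
        rw [this]; exact hv'
      have heq : par a = par (lab y) :=
        Finset.eq_of_subset_of_card_le hsub (by rw [hy.2, a.2])
      funext v
      by_cases hv : Odd ((a : κ → ℤ) v)
      · exact glab_odd_of hv (hya v)
      · refine glab_even_of hv ?_ (hya v)
        intro ho
        have : v ∈ par (lab y) := Finset.mem_filter.2 ⟨Finset.mem_univ _, ho⟩
        rw [← heq] at this
        exact hv (Finset.mem_filter.1 this).2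
    have h1 := key a (hyO a (by simp))
    have h2 := key b (hyO b (by simp))
    exact Subtype.ext (Subtype.ext (h1.symm.trans h2))
  choose V' g1 g2 g3 g4 using hsw
  let V : ι → Set (κ → ℝ) := fun k => ⋃ a : lab '' X, ⋃ _ : i a = k, V' _ ⟨a, rfl⟩
  refine ⟨V, ?_, ?_, ?_, ?_⟩
  · intro k
    exact isOpen_iUnion fun a => isOpen_iUnion fun _ => g1 _ _
  · intro k
    refine iUnion_subset fun a => iUnion_subset fun h => ?_
    rw [← h]
    exact (g2 _ _).trans inter_subset_right
  · intro x hx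
    refine mem_iUnion.2 ⟨i ⟨lab x, x, hx, rfl⟩, mem_iUnion.2 ⟨⟨lab x, x, hx, rfl⟩,
      mem_iUnion.2 ⟨rfl, ?_⟩⟩⟩
    have hO' : x ∈ O ⟨lab x, x, hx, rfl⟩ :=
      ⟨fun v => glab_lt (c * x v), hi ⟨lab x, x, hx, rfl⟩ x hx rfl⟩
    exact g3 (par (lab x)).card ⟨⟨lab x, x, hx, rfl⟩, rfl⟩ ⟨⟨hx, rfl⟩, hO'⟩
  · intro x _ I hI
    have : ∀ k ∈ I, ∃ a : lab '' X, i a = k ∧ x ∈ V' _ ⟨a, rfl⟩ := by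
      intro k hk
      obtain ⟨a, ha⟩ := mem_iUnion.1 (hI k hk)
      obtain ⟨h, hx⟩ := mem_iUnion.1 ha
      exact ⟨a, h, hx⟩
    rcases I.eq_empty_or_nonempty with rfl | ⟨k0, hk0⟩
    · simp
    have hne : Nonempty (lab '' X) := ⟨(this k0 hk0).choose⟩
    choose! a ha1 ha2 using this
    have hinj : ∀ k ∈ I, ∀ k' ∈ I, (par (a k)).card = (par (a k')).card → k = k' := by
      intro k hk k' hk' h
      have e : ∀ l, ∀ hl : (par (a k)).card = l, x ∈ V' l ⟨a k, hl⟩ := by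
        rintro l rfl; exact ha2 k hk
      have := g4 _ x _ _ (e _ h) (ha2 k' hk')
      have this2 : a k = a k' := congrArg Subtype.val this
      rw [← ha1 k hk, ← ha1 k' hk', this2]
    have := Finset.card_le_card_of_injOn (s := I) (t := Finset.range (Fintype.card κ + 1))
      (fun k => (par (a k)).card)
      (fun k _ => by
        simp only [Finset.coe_range, mem_Iio]
        exact Nat.lt_succ_of_le (Finset.card_le_univ _))
      (fun k hk k' hk' h => hinj k hk k' hk' h)
    simpa using this

/-- A convergent sequence with its limit. -/
abbrev Wseq : Type := {x : ℝ // x = 0 ∨ ∃ k : ℕ, x = 1 / ((k : ℝ) + 1)}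

theorem Wseq.nonneg (w : Wseq) : 0 ≤ (w : ℝ) := by
  rcases w.2 with h | ⟨k, h⟩ <;> rw [h]
  positivity

theorem Wseq.isOpen_singleton (w : Wseq) (hw : (w : ℝ) ≠ 0) : IsOpen ({w} : Set Wseq) := by
  obtain ⟨k, hk⟩ := w.2.resolve_left hw
  have hlt : 1 / ((k : ℝ) + 2) < 1 / ((k : ℝ) + 1) :=
    one_div_lt_one_div_of_lt (by positivity) (by linarith)
  have : ({w} : Set Wseq) = Subtype.val ⁻¹' (Ioi (1 / ((k : ℝ) + 2))) ∩
      (if k = 0 then univ else Subtype.val ⁻¹' (Iio (1 / (k : ℝ)))) := by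
    ext v
    simp only [mem_singleton_iff, mem_inter_iff, mem_preimage, mem_Ioi]
    constructor
    · rintro rfl
      refine ⟨by rw [hk]; exact hlt, ?_⟩
      split_ifs with h0
      · trivial
      · show (v : ℝ) < _
        rw [hk]
        have : (0 : ℝ) < k := by positivity
        exact one_div_lt_one_div_of_lt this (by linarith)
    · rintro ⟨h1, h2⟩
      apply Subtype.ext
      rw [hk]
      rcases v.2 with h | ⟨l, h⟩
      · rw [h] at h1
        have : (0 : ℝ) < 1 / ((k : ℝ) + 2) := by positivity
        linarith
      · rw [h] at h1 ⊢
        have h3 : (l : ℝ) + 1 < k + 2 := (one_div_lt_one_div (by positivity) (by positivity)).1 h1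
        have h3' : l < k + 1 := by
          have : ((l + 1 : ℕ) : ℝ) < ((k + 2 : ℕ) : ℝ) := by push_cast; exact h3
          have := Nat.cast_lt.1 this
          omega
        have h4 : k ≤ l := by
          split_ifs at h2 with h0
          · omega
          · have h2' : (v : ℝ) < 1 / (k : ℝ) := h2
            rw [h] at h2'
            have hk0 : (0 : ℝ) < k := by positivity
            have := (one_div_lt_one_div (by positivity) hk0).1 h2'
            have : ((k : ℕ) : ℝ) < ((l + 1 : ℕ) : ℝ) := by push_cast; exact this
            have := Nat.cast_lt.1 this
            omega
        have : l = k := by omega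
        rw [this]
  rw [this]
  refine IsOpen.inter (isOpen_Ioi.preimage continuous_subtype_val) ?_
  split_ifs
  · exact isOpen_univ
  · exact isOpen_Iio.preimage continuous_subtype_val

theorem covDimLE_of_univ {E : Type} [TopologicalSpace E] {n : ℕ}
    (h : CovOn (univ : Set E) n) : CovDimLE E n := by
  rintro 𝒰 ⟨u1, u2⟩
  obtain ⟨V, v1, v2, v3, v4⟩ := h 𝒰 (fun u => u) (fun u => u1 u u.2)
    (by rw [← sUnion_eq_iUnion, u2])
  refine ⟨range V, ⟨?_, ?_⟩, ?_, ?_⟩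
  · rintro _ ⟨u, rfl⟩
    exact v1 u
  · rw [sUnion_range]; exact univ_subset_iff.1 v3
  · rintro _ ⟨u, rfl⟩
    exact ⟨u, u.2, v2 u⟩
  · intro x
    have hfin : {u : 𝒰 | x ∈ V u}.Finite := by
      by_contra hinf
      obtain ⟨t, ht, hc⟩ := Set.Infinite.exists_subset_card_eq hinf (n + 2)
      have := v4 x trivial t (fun i hi => ht hi)
      omega
    have hsub : {v ∈ range V | x ∈ v} ⊆ V '' {u : 𝒰 | x ∈ V u} := by
      rintro _ ⟨⟨u, rfl⟩, hx⟩
      exact ⟨u, hx, rfl⟩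
    refine ⟨(hfin.image _).subset hsub, ?_⟩
    refine (Set.ncard_le_ncard hsub (hfin.image _)).trans ((Set.ncard_image_le hfin).trans ?_)
    rw [Set.ncard_eq_toFinset_card _ hfin]
    exact v4 x trivial _ (by simp)

theorem covDimLE_prod {Z : Type} [TopologicalSpace Z] [TopologicalSpace.MetrizableSpace Z] {n : ℕ}
    (hZ : CovDimLE Z n) : CovDimLE (Z × Wseq) n := by
  apply covDimLE_of_univ
  have hr : ∀ w : Wseq, CovOn (range fun z : Z => (z, w)) n := fun w =>
    CovOn.range_of_covDimLE hZ _ (isEmbedding_prodMkLeft w).isInducing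
  have hr' : ∀ w : Wseq, (range fun z : Z => (z, w)) = {q | q.2 = w} := by
    intro w; ext ⟨z, v⟩; simp [eq_comm]
  have hw0 : IsClosed {q : Z × Wseq | (q.2 : ℝ) = 0} :=
    isClosed_eq (by fun_prop) continuous_const
  refine CovOn.sum_closed hw0 ?_ ?_
  · have := hr ⟨0, Or.inl rfl⟩
    rw [hr'] at this
    convert this using 1
    ext q
    simp [Subtype.ext_iff]
  · intro N hN hdis
    refine CovOn.disjoint_sum (κ := {w : Wseq // (w : ℝ) ≠ 0})
      (fun w => {q | q.2 = w.1}) ?_ ?_ ?_ ?_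
    · intro w
      exact (Wseq.isOpen_singleton w.1 w.2).preimage continuous_snd
    · rintro q ⟨-, hq⟩
      have : (q.2 : ℝ) ≠ 0 := by
        intro h
        have : q ∈ univ ∩ N ∩ {q : Z × Wseq | (q.2 : ℝ) = 0} := ⟨⟨trivial, hq⟩, h⟩
        rw [hdis] at this
        exact this
      exact mem_iUnion.2 ⟨⟨q.2, this⟩, rfl⟩
    · intro x _ k l hk hl
      exact Subtype.ext (hk.symm.trans hl)
    · intro w
      have := (hr w.1).inter_closed hN
      rw [hr'] at this
      convert this using 1
      ext q
      simp [and_comm]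

theorem IsZSet.exists_small {Y : Type} [MetricSpace Y] {F : Set Y} (hF : IsZSet F) {w : ℝ}
    (hw : 0 < w) : ∃ h : C(Y, Y), (∀ y, dist (h y) y < w) ∧ ∀ y, h y ∉ F := by
  obtain ⟨f, h1, h2⟩ := hF.2 (range fun y : Y => Metric.ball y (w / 2))
    ⟨by rintro _ ⟨y, rfl⟩; exact Metric.isOpen_ball, by
      refine eq_univ_of_forall fun y => ?_
      exact mem_sUnion.2 ⟨_, mem_range_self y, Metric.mem_ball_self (by linarith)⟩⟩
  refine ⟨f, fun y => ?_, fun y hy => ?_⟩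
  · obtain ⟨_, ⟨c, rfl⟩, ha, hb⟩ := h1 y
    rw [Metric.mem_ball] at ha hb
    have := dist_triangle_right (f y) y c
    rw [id] at hb
    linarith
  · have : f y ∈ range ⇑f ∩ F := ⟨mem_range_self y, hy⟩
    rw [h2] at this
    exact this

theorem perturb {Z Y : Type} [MetricSpace Z] [TopologicalSpace.SeparableSpace Z] [MetricSpace Y]
    {n : ℕ} (hZ : CovDimLE (Z × Wseq) n) (hAE : IsAbsExtensorInDim n Y) {Y0 C : Set Z}
    (hY0 : IsClosed Y0) (hC : IsCompact C) (hCne : C.Nonempty) (hdis : Disjoint C Y0) {F : Set Y}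
    (hF : IsZSet F) (p : C(Z, Y)) {ε : ℝ} (hε : 0 < ε) :
    ∃ p' : C(Z, Y), (∀ z ∈ Y0, p' z = p z) ∧ (∀ z, dist (p' z) (p z) < ε) ∧
      ∀ z ∈ C, p' z ∉ F := by
  classical
  have hh : ∀ w : Wseq, (w : ℝ) ≠ 0 →
      ∃ h : C(Y, Y), (∀ y, dist (h y) y < w) ∧ ∀ y, h y ∉ F := fun w hw =>
    hF.exists_small (lt_of_le_of_ne w.nonneg (Ne.symm hw))
  have hid : Nonempty C(Y, Y) := ⟨ContinuousMap.id Y⟩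
  choose! h hh1 hh2 using hh
  let B : Set (Z × Wseq) := {q | q.1 ∈ C ∨ (q.2 : ℝ) ≤ Metric.infDist q.1 C}
  have hB : IsClosed B := by
    have h1 : IsClosed {q : Z × Wseq | q.1 ∈ C} := hC.isClosed.preimage continuous_fst
    have h2 : IsClosed {q : Z × Wseq | (q.2 : ℝ) ≤ Metric.infDist q.1 C} :=
      isClosed_le (by fun_prop) ((Metric.continuous_infDist_pt C).comp continuous_fst)
    exact h1.union h2
  let g : Z × Wseq → Y := fun q => if (q.2 : ℝ) ≠ 0 ∧ q.1 ∈ C then h q.2 (p q.1) else p q.1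
  have hgd : ∀ q : Z × Wseq, dist (g q) (p q.1) ≤ q.2 := by
    intro q
    simp only [g]
    split_ifs with hq
    · exact (hh1 q.2 hq.1 _).le
    · rw [dist_self]; exact q.2.nonneg
  have hg : ContinuousOn g B := by
    rintro ⟨z, w⟩ hzw
    by_cases hw : (w : ℝ) = 0
    · have hgq : g (z, w) = p z := by simp [g, hw]
      show Filter.Tendsto g (𝓝[B] (z, w)) (𝓝 (g (z, w)))
      rw [hgq, tendsto_iff_dist_tendsto_zero]
      have hlim : Filter.Tendsto (fun q : Z × Wseq => (q.2 : ℝ) + dist (p q.1) (p z))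
          (𝓝[B] (z, w)) (𝓝 0) := by
        have : Continuous (fun q : Z × Wseq => (q.2 : ℝ) + dist (p q.1) (p z)) := by fun_prop
        have h2 := (this.tendsto (z, w)).mono_left (nhdsWithin_le_nhds (s := B))
        simpa [hw] using h2
      refine squeeze_zero (fun _ => dist_nonneg) (fun q => ?_) hlim
      have := dist_triangle (g q) (p q.1) (p z)
      have := hgd q
      linarith
    · have hwp : 0 < (w : ℝ) := lt_of_le_of_ne w.nonneg (Ne.symm hw)
      have hS : {q : Z × Wseq | q.2 = w} ∈ 𝓝 (z, w) :=
        ((Wseq.isOpen_singleton w hw).preimage continuous_snd).mem_nhds rfl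
      by_cases hz : z ∈ C
      · have hS2 : {q : Z × Wseq | Metric.infDist q.1 C < w} ∈ 𝓝 (z, w) := by
          refine IsOpen.mem_nhds (isOpen_lt
            ((Metric.continuous_infDist_pt C).comp continuous_fst) continuous_const) ?_
          show Metric.infDist z C < w
          rw [Metric.infDist_zero_of_mem hz]; exact hwp
        have hcont : ContinuousAt (fun q : Z × Wseq => h w (p q.1)) (z, w) := by fun_prop
        refine (hcont.continuousWithinAt (s := B)).congr_of_eventuallyEq ?_ ?_
        · filter_upwards [mem_nhdsWithin_of_mem_nhds hS, mem_nhdsWithin_of_mem_nhds hS2,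
            self_mem_nhdsWithin] with q h1 h2 h3
          have h3 : q.1 ∈ C ∨ (q.2 : ℝ) ≤ Metric.infDist q.1 C := h3
          have : q.1 ∈ C := by
            rcases h3 with h3 | h3
            · exact h3
            · rw [h1] at h3; linarith
          simp [g, h1, hw, this]
        · simp [g, hw, hz]
      · have hS2 : {q : Z × Wseq | q.1 ∉ C} ∈ 𝓝 (z, w) :=
          (hC.isClosed.isOpen_compl.preimage continuous_fst).mem_nhds hz
        have hcont : ContinuousAt (fun q : Z × Wseq => p q.1) (z, w) := by fun_prop
        refine (hcont.continuousWithinAt (s := B)).congr_of_eventuallyEq ?_ ?_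
        · filter_upwards [mem_nhdsWithin_of_mem_nhds hS2] with q h1
          simp [g, h1]
        · simp [g, hz]
  obtain ⟨G, hG⟩ := hAE (Z × Wseq) hZ B hB ⟨B.domRestrict g, hg.domRestrict⟩
  have hG' : ∀ q ∈ B, G q = g q := fun q hq => hG ⟨q, hq⟩
  let w0 : Wseq := ⟨0, Or.inl rfl⟩
  have hopen : IsOpen {q : Z × Wseq | dist (G q) (p q.1) < ε ∧ q.1 ∉ Y0} := by
    have h1 : IsOpen {q : Z × Wseq | dist (G q) (p q.1) < ε} :=
      isOpen_lt (by fun_prop) continuous_const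
    refine h1.inter ?_
    exact hY0.isOpen_compl.preimage continuous_fst
  have hsub : C ×ˢ ({w0} : Set Wseq) ⊆ {q : Z × Wseq | dist (G q) (p q.1) < ε ∧ q.1 ∉ Y0} := by
    rintro ⟨z, w⟩ ⟨hz, hw⟩
    have hw' : w = w0 := hw
    subst hw'
    refine ⟨?_, fun h => disjoint_left.1 hdis hz h⟩
    rw [hG' _ (Or.inl hz)]
    exact lt_of_le_of_lt (hgd _) hε
  obtain ⟨U, N, hU, hN, hCU, hwN, hUN⟩ := generalized_tube_lemma hC isCompact_singleton hopen hsub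
  obtain ⟨δ, hδ, hthick⟩ := hC.exists_thickening_subset_open hU hCU
  have hw0N : N ∈ 𝓝 w0 := hN.mem_nhds (hwN rfl)
  obtain ⟨η, hη, hball⟩ := Metric.mem_nhds_iff.1 hw0N
  obtain ⟨k, hk⟩ := exists_nat_one_div_lt (lt_min hδ hη)
  have hkp : (0 : ℝ) < 1 / ((k : ℝ) + 1) := by positivity
  let w : Wseq := ⟨1 / ((k : ℝ) + 1), Or.inr ⟨k, rfl⟩⟩
  have hwN' : w ∈ N := by
    apply hball
    rw [Metric.mem_ball, Subtype.dist_eq, Real.dist_eq]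
    show |1 / ((k : ℝ) + 1) - 0| < η
    rw [sub_zero, abs_of_pos hkp]
    exact hk.trans_le (min_le_right _ _)
  have hout : ∀ z, z ∉ C → (w : ℝ) ≤ Metric.infDist z C → G (z, w) = p z := by
    intro z hz hzw
    rw [hG' (z, w) (Or.inr hzw)]
    simp [g, hz]
  have hin : ∀ z, ¬ (z ∉ C ∧ (w : ℝ) ≤ Metric.infDist z C) → z ∈ U := by
    intro z hz
    by_cases hzC : z ∈ C
    · exact hCU hzC
    · apply hthick
      have : Metric.infDist z C < w := by
        by_contra hcon
        exact hz ⟨hzC, not_lt.1 hcon⟩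
      rw [Metric.mem_thickening_iff]
      obtain ⟨y, hy, hzy⟩ := (Metric.infDist_lt_iff hCne).1 this
      exact ⟨y, hy, hzy.trans (hk.trans_le (min_le_left _ _))⟩
  refine ⟨⟨fun z => G (z, w), by fun_prop⟩, ?_, ?_, ?_⟩
  · intro z hz
    show G (z, w) = p z
    by_cases hc : z ∉ C ∧ (w : ℝ) ≤ Metric.infDist z C
    · exact hout z hc.1 hc.2
    · have hmem : (z, w) ∈ U ×ˢ N := ⟨hin z hc, hwN'⟩
      exact absurd hz (hUN hmem).2
  · intro z
    show dist (G (z, w)) (p z) < ε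
    by_cases hc : z ∉ C ∧ (w : ℝ) ≤ Metric.infDist z C
    · rw [hout z hc.1 hc.2, dist_self]; exact hε
    · have hmem : (z, w) ∈ U ×ˢ N := ⟨hin z hc, hwN'⟩
      exact (hUN hmem).1
  · intro z hz
    show G (z, w) ∉ F
    rw [hG' (z, w) (Or.inl hz)]
    have : (w : ℝ) ≠ 0 := hkp.ne'
    simp only [g, this, hz, ne_eq, not_false_eq_true, and_self, if_true]
    exact hh2 w this _

theorem avoid {Z Y : Type} [MetricSpace Z] [TopologicalSpace.SeparableSpace Z] [MetricSpace Y]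
    [CompleteSpace Y]
    {n : ℕ} (hZ : CovDimLE (Z × Wseq) n) (hAE : IsAbsExtensorInDim n Y) {Y0 : Set Z}
    (hY0 : IsClosed Y0) {κ : Type} [Countable κ] {C : κ → Set Z} (hC : ∀ i, IsCompact (C i))
    (hdis : ∀ i, Disjoint (C i) Y0) {F : ℕ → Set Y}
    (hF : ∀ j, IsZSet (F j)) (p0 : C(Z, Y)) :
    ∃ p : C(Z, Y), (∀ z ∈ Y0, p z = p0 z) ∧ ∀ i j, ∀ z ∈ C i, p z ∉ F j := by
  let M : Set (UniformFun Z Y) := {f | Continuous (UniformFun.toFun f)} ∩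
    ⋂ z ∈ Y0, {f | UniformFun.toFun f z = p0 z}
  have hM : IsClosed M := by
    refine IsClosed.inter (UniformFun.isClosed_setOfPred_continuous Z) (isClosed_biInter fun z _ => ?_)
    exact isClosed_eq (UniformFun.uniformContinuous_eval Y z).continuous continuous_const
  have hcg : (uniformity (UniformFun Z Y)).IsCountablyGenerated := by
    obtain ⟨s, hs⟩ := (uniformity Y).exists_antitone_basis
    exact (UniformFun.hasBasis_uniformity_of_basis Z Y hs.1).isCountablyGenerated
  have hcM : CompleteSpace M := hM.completeSpace_coe
  have hcgM : (uniformity M).IsCountablyGenerated := by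
    rw [uniformity_subtype]; infer_instance
  have hbaire : BaireSpace M := inferInstance
  have hbas : ∀ f : UniformFun Z Y, (𝓝 f).HasBasis (fun ε : ℝ => 0 < ε)
      fun ε => {g | ∀ z, dist (UniformFun.toFun f z) (UniformFun.toFun g z) < ε} := fun f =>
    UniformFun.hasBasis_nhds_of_basis Z Y f Metric.uniformity_basis_dist
  let O : κ × ℕ → Set M := fun k => {f | ∀ z ∈ C k.1, UniformFun.toFun f.1 z ∉ F k.2}
  have hOo : ∀ k, IsOpen (O k) := by
    intro k
    rw [isOpen_iff_mem_nhds]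
    intro f hf
    have hK : IsCompact (UniformFun.toFun f.1 '' C k.1) := (hC k.1).image f.2.1
    obtain ⟨δ, hδ, hth⟩ := hK.exists_thickening_subset_open (hF k.2).1.isOpen_compl
      (by rintro _ ⟨z, hz, rfl⟩; exact hf z hz)
    have : {g | ∀ z, dist (UniformFun.toFun f.1 z) (UniformFun.toFun g z) < δ} ∈ 𝓝 f.1 :=
      (hbas f.1).mem_of_mem hδ
    filter_upwards [continuous_subtype_val.continuousAt.preimage_mem_nhds this] with g hg
    intro z hz
    apply hth
    rw [Metric.mem_thickening_iff]
    refine ⟨_, mem_image_of_mem _ hz, ?_⟩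
    rw [dist_comm]
    exact hg z
  have hOd : ∀ k, Dense (O k) := by
    intro k f
    rw [mem_closure_iff_nhds]
    intro t ht
    rw [nhds_subtype_eq_comap, ((hbas f.1).comap _).mem_iff] at ht
    obtain ⟨ε, hε, ht⟩ := ht
    rcases (C k.1).eq_empty_or_nonempty with he | hne
    · refine ⟨f, ht ?_, ?_⟩
      · intro z; rw [dist_self]; exact hε
      · intro z hz; rw [he] at hz; exact hz.elim
    · obtain ⟨p', h1, h2, h3⟩ := perturb hZ hAE hY0 (hC k.1) hne (hdis k.1) (hF k.2)
        ⟨UniformFun.toFun f.1, f.2.1⟩ hε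
      have hf2 := f.2.2
      refine ⟨⟨UniformFun.ofFun p', p'.continuous, ?_⟩, ht ?_, h3⟩
      · refine mem_iInter₂.2 fun z hz => ?_
        exact (h1 z hz).trans (mem_iInter₂.1 hf2 z hz)
      · intro z
        rw [dist_comm]; exact h2 z
  have hd := dense_iInter_of_isOpen hOo hOd
  have hMne : Nonempty M := ⟨⟨UniformFun.ofFun p0, p0.continuous, mem_iInter₂.2 fun z _ => rfl⟩⟩
  obtain ⟨f, hf⟩ := hd.nonempty
  refine ⟨⟨UniformFun.toFun f.1, f.2.1⟩, fun z hz => mem_iInter₂.1 f.2.2 z hz, ?_⟩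
  intro i j z hz
  exact mem_iInter.1 hf (i, j) z hz

/-- The ambient space of the complex. -/
abbrev EE : Type := (ℕ → ℝ) × (ℕ → ℝ)

/-- The face spanned by the vertices with labels in `σ`. -/
def face {Y : Type} [MetricSpace Y] (s : ℕ → Y) (σ : Finset ℕ) : Set EE :=
  {e | (∀ i, 0 ≤ e.2 i) ∧ (∀ i, i ∉ σ → e.2 i = 0) ∧ ∑ i ∈ σ, e.2 i = 1 ∧
    ∀ j, e.1 j = ∑ i ∈ σ, e.2 i * dist (s i) (s j)}

/-- The embedding of `Y`. -/
def e0 {Y : Type} [MetricSpace Y] (s : ℕ → Y) (y : Y) : EE := (fun j => dist y (s j), 0)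

/-- The `n`-dimensional complex. -/
def KK {Y : Type} [MetricSpace Y] (s : ℕ → Y) (n : ℕ) : Set EE :=
  {e | ∃ σ : Finset ℕ, σ.card ≤ n + 1 ∧ e ∈ face s σ}

/-- Points with at most `j` nonzero barycentric coordinates. -/
def lowrank (j : ℕ) : Set EE := {e | ∀ τ : Finset ℕ, τ.card = j + 1 → ∃ i ∈ τ, e.2 i = 0}

theorem isInducing_e0 {Y : Type} [MetricSpace Y] {s : ℕ → Y} (hs : DenseRange s) :
    IsInducing (e0 s) := by
  rw [isInducing_iff_nhds]
  intro y
  apply le_antisymm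
  · rw [← Filter.map_le_iff_le_comap]
    have : Continuous (e0 s) := by unfold e0; fun_prop
    exact this.continuousAt
  · intro t ht
    obtain ⟨ε, hε, hb⟩ := Metric.mem_nhds_iff.1 ht
    obtain ⟨j, hj⟩ := hs.exists_dist_lt y (half_pos hε)
    refine Filter.mem_comap.2 ⟨{e | e.1 j < ε / 2}, ?_, ?_⟩
    · refine IsOpen.mem_nhds (isOpen_lt (by fun_prop) continuous_const) ?_
      exact hj
    · intro y' hy'
      have hy' : dist y' (s j) < ε / 2 := hy'
      apply hb
      rw [Metric.mem_ball]
      have := dist_triangle_right y' y (s j)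
      linarith

theorem isCompact_face {Y : Type} [MetricSpace Y] (s : ℕ → Y) (σ : Finset ℕ) :
    IsCompact (face s σ) := by
  have h1 : IsClosed {t : ℕ → ℝ | (∀ i, 0 ≤ t i) ∧ (∀ i, i ∉ σ → t i = 0) ∧
      ∑ i ∈ σ, t i = 1} := by
    have a1 : IsClosed {t : ℕ → ℝ | ∀ i, 0 ≤ t i} := by
      simp only [Set.ofPred_forall]
      exact isClosed_iInter fun i => isClosed_le continuous_const (by fun_prop)
    have a2 : IsClosed {t : ℕ → ℝ | ∀ i, i ∉ σ → t i = 0} := by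
      simp only [Set.ofPred_forall]
      exact isClosed_iInter fun i => isClosed_iInter fun _ =>
        isClosed_eq (by fun_prop) continuous_const
    have a3 : IsClosed {t : ℕ → ℝ | ∑ i ∈ σ, t i = 1} :=
      isClosed_eq (by fun_prop) continuous_const
    exact a1.inter (a2.inter a3)
  have h2 : IsCompact {t : ℕ → ℝ | (∀ i, 0 ≤ t i) ∧ (∀ i, i ∉ σ → t i = 0) ∧
      ∑ i ∈ σ, t i = 1} := by
    refine (isCompact_univ_pi (fun _ : ℕ => isCompact_Icc (a := (0 : ℝ)) (b := 1))).of_isClosed_subset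
      h1 ?_
    rintro t ⟨t1, t2, t3⟩ i -
    refine ⟨t1 i, ?_⟩
    by_cases hi : i ∈ σ
    · rw [← t3]; exact Finset.single_le_sum (f := t) (fun i _ => t1 i) hi
    · rw [t2 i hi]; norm_num
  have h3 : Continuous fun t : ℕ → ℝ =>
      ((fun j => ∑ i ∈ σ, t i * dist (s i) (s j), t) : EE) := by fun_prop
  convert h2.image h3 using 1
  ext e
  constructor
  · rintro ⟨b1, b2, b3, b4⟩
    exact ⟨e.2, ⟨b1, b2, b3⟩, Prod.ext (funext fun j => (b4 j).symm) rfl⟩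
  · rintro ⟨t, ⟨t1, t2, t3⟩, rfl⟩
    exact ⟨t1, t2, t3, fun j => rfl⟩

theorem face_change {Y : Type} [MetricSpace Y] {s : ℕ → Y} {σ τ : Finset ℕ} {e : EE}
    (he : e ∈ face s τ) (h : ∀ i, i ∉ σ → e.2 i = 0) : e ∈ face s σ := by
  classical
  obtain ⟨h1, h2, h3, h4⟩ := he
  have key : ∀ a : ℕ → ℝ, ∑ i ∈ τ, e.2 i * a i = ∑ i ∈ σ, e.2 i * a i := by
    intro a
    have k1 : ∑ i ∈ τ, e.2 i * a i = ∑ i ∈ σ ∪ τ, e.2 i * a i :=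
      Finset.sum_subset Finset.subset_union_right fun i _ hi => by rw [h2 i hi, zero_mul]
    have k2 : ∑ i ∈ σ, e.2 i * a i = ∑ i ∈ σ ∪ τ, e.2 i * a i :=
      Finset.sum_subset Finset.subset_union_left fun i _ hi => by rw [h i hi, zero_mul]
    rw [k1, k2]
  refine ⟨h1, h, ?_, fun j => by rw [h4 j, key]⟩
  have := key fun _ => 1
  simp only [mul_one] at this
  rw [← this, h3]

theorem covOn_face {Y : Type} [MetricSpace Y] (s : ℕ → Y) {σ : Finset ℕ} {j : ℕ}
    (hσ : σ.card = j + 1) {N : Set EE} (hN : IsClosed N) : CovOn (face s σ ∩ N) j := by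
  classical
  obtain ⟨i0, hi0⟩ : σ.Nonempty := Finset.card_pos.1 (by omega)
  have hM : IsCompact (face s σ ∩ N) := (isCompact_face s σ).inter_right hN
  let ψ : EE → ({i // i ∈ σ.erase i0} → ℝ) := fun e i => e.2 i
  have hψ : Continuous ψ := by fun_prop
  refine CovOn.of_injOn hM ψ hψ ?_ ?_
  · rintro e ⟨⟨a1, a2, a3, a4⟩, -⟩ e' ⟨⟨b1, b2, b3, b4⟩, -⟩ h
    have h1 : ∀ i ∈ σ.erase i0, e.2 i = e'.2 i := fun i hi => congrFun h ⟨i, hi⟩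
    have h2 : e.2 i0 = e'.2 i0 := by
      rw [← Finset.add_sum_erase _ _ hi0] at a3 b3
      rw [Finset.sum_congr rfl h1] at a3
      linarith
    have h3 : e.2 = e'.2 := by
      funext i
      by_cases hi : i ∈ σ
      · by_cases hii : i = i0
        · rw [hii, h2]
        · exact h1 i (Finset.mem_erase.2 ⟨hii, hi⟩)
      · rw [a2 i hi, b2 i hi]
    refine Prod.ext (funext fun k => ?_) h3
    rw [a4, b4, h3]
  · have := CovOn.compact_pi (hM.image hψ)
    rwa [Fintype.card_coe, Finset.card_erase_of_mem hi0, hσ, Nat.add_sub_cancel] at this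

theorem isClosed_lowrank (j : ℕ) : IsClosed (lowrank j) := by
  unfold lowrank
  simp only [Set.ofPred_forall]
  refine isClosed_iInter fun τ => isClosed_iInter fun _ => ?_
  have : {e : EE | ∃ i ∈ τ, e.2 i = 0} = ⋃ i ∈ τ, {e : EE | e.2 i = 0} := by ext; simp
  rw [this]
  exact isClosed_biUnion_finset fun i _ => isClosed_eq (by fun_prop) continuous_const

theorem face_lowrank {Y : Type} [MetricSpace Y] {s : ℕ → Y} {σ : Finset ℕ} {j : ℕ}
    (hσ : σ.card ≤ j) : face s σ ⊆ lowrank j := by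
  rintro e ⟨-, h, -⟩ τ hτ
  by_contra hcon
  push Not at hcon
  have : τ ⊆ σ := by
    intro i hi
    by_contra hi2
    exact hcon i hi (h i hi2)
  have := Finset.card_le_card this
  omega

theorem covOn_low {Y : Type} [MetricSpace Y] (s : ℕ → Y) (n : ℕ) : ∀ j, j ≤ n + 1 →
    CovOn (KK s n ∩ lowrank j) n := by
  classical
  intro j
  induction j with
  | zero =>
    intro _
    have : KK s n ∩ lowrank 0 = ∅ := by
      refine eq_empty_of_forall_notMem ?_
      rintro e ⟨⟨σ, -, -, -, h3, -⟩, h⟩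
      have : ∀ i ∈ σ, e.2 i = 0 := by
        intro i _
        obtain ⟨k, hk, hk2⟩ := h {i} (by simp)
        rw [Finset.mem_singleton] at hk
        rwa [hk] at hk2
      rw [Finset.sum_eq_zero this] at h3
      exact zero_ne_one h3
    rw [this]; exact CovOn.empty n
  | succ j ih =>
    intro hj
    refine CovOn.sum_closed (isClosed_lowrank j) ?_ ?_
    · have : KK s n ∩ lowrank (j + 1) ∩ lowrank j = KK s n ∩ lowrank j := by
        ext e
        constructor
        · rintro ⟨⟨h1, -⟩, h2⟩; exact ⟨h1, h2⟩
        · rintro ⟨h1, h2⟩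
          refine ⟨⟨h1, ?_⟩, h2⟩
          intro τ hτ
          obtain ⟨k, hk⟩ : τ.Nonempty := Finset.card_pos.1 (by omega)
          obtain ⟨i, hi, hi2⟩ := h2 (τ.erase k) (by rw [Finset.card_erase_of_mem hk]; omega)
          exact ⟨i, Finset.mem_of_mem_erase hi, hi2⟩
      rw [this]
      exact ih (by omega)
    · intro N hN hemp
      have hnl : ∀ e, e ∈ KK s n → e ∈ lowrank (j + 1) → e ∈ N →
          ∃ τ : Finset ℕ, τ.card = j + 1 ∧ ∀ i ∈ τ, e.2 i ≠ 0 := by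
        intro e h1 h2 h3
        by_contra hcon
        push Not at hcon
        have : e ∈ KK s n ∩ lowrank (j + 1) ∩ N ∩ lowrank j := ⟨⟨⟨h1, h2⟩, h3⟩, hcon⟩
        rw [hemp] at this
        exact this
      have hsup : ∀ e, e ∈ lowrank (j + 1) → ∀ σ : Finset ℕ, σ.card = j + 1 →
          (∀ i ∈ σ, e.2 i ≠ 0) → ∀ i, i ∉ σ → e.2 i = 0 := by
        intro e he σ hσ hne i hi
        obtain ⟨k, hk, hk2⟩ := he (insert i σ) (by rw [Finset.card_insert_of_notMem hi, hσ])
        rcases Finset.mem_insert.1 hk with rfl | hk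
        · exact hk2
        · exact absurd hk2 (hne k hk)
      refine CovOn.disjoint_sum (κ := {σ : Finset ℕ // σ.card = j + 1})
        (fun σ => {e | ∀ i ∈ σ.1, e.2 i ≠ 0}) ?_ ?_ ?_ ?_
      · intro σ
        have : {e : EE | ∀ i ∈ σ.1, e.2 i ≠ 0} = ⋂ i ∈ σ.1, {e : EE | e.2 i ≠ 0} := by ext; simp
        rw [this]
        exact isOpen_biInter_finset fun i _ => isOpen_ne_fun (by fun_prop) continuous_const
      · rintro e ⟨⟨h1, h2⟩, h3⟩
        obtain ⟨τ, hτ, hτ2⟩ := hnl e h1 h2 h3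
        exact mem_iUnion.2 ⟨⟨τ, hτ⟩, hτ2⟩
      · rintro e ⟨⟨h1, h2⟩, h3⟩ σ τ hσ hτ
        apply Subtype.ext
        refine (Finset.eq_of_subset_of_card_le (fun i hi => ?_) (by rw [σ.2, τ.2]))
        by_contra hi2
        exact hσ i hi (hsup e h2 τ.1 τ.2 hτ i hi2)
      · intro σ
        have : KK s n ∩ lowrank (j + 1) ∩ N ∩ {e | ∀ i ∈ σ.1, e.2 i ≠ 0} = face s σ.1 ∩ N := by
          ext e
          constructor
          · rintro ⟨⟨⟨⟨τ, -, h1⟩, h2⟩, h3⟩, h4⟩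
            exact ⟨face_change h1 (hsup e h2 σ.1 σ.2 h4), h3⟩
          · rintro ⟨h1, h2⟩
            have hK : e ∈ KK s n := ⟨σ.1, by rw [σ.2]; exact hj, h1⟩
            have hl : e ∈ lowrank (j + 1) := face_lowrank (by rw [σ.2]) h1
            refine ⟨⟨⟨hK, hl⟩, h2⟩, ?_⟩
            obtain ⟨τ, hτ, hτ2⟩ := hnl e hK hl h2
            have hsub : τ ⊆ σ.1 := by
              intro i hi
              by_contra hi2
              exact hτ2 i hi (h1.2.1 i hi2)
            have := Finset.eq_of_subset_of_card_le hsub (by rw [σ.2, hτ])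
            rw [← this]
            exact hτ2
        rw [this]
        exact (covOn_face s σ.2 hN).mono (by omega)

theorem covOn_KK {Y : Type} [MetricSpace Y] (s : ℕ → Y) (n : ℕ) : CovOn (KK s n) n := by
  have := covOn_low s n (n + 1) le_rfl
  rwa [inter_eq_left.2] at this
  rintro e ⟨σ, hσ, he⟩
  exact face_lowrank hσ he

theorem KK_snd_ne {Y : Type} [MetricSpace Y] {s : ℕ → Y} {n : ℕ} {e : EE} (he : e ∈ KK s n) :
    e.2 ≠ 0 := by
  obtain ⟨σ, -, -, -, h3, -⟩ := he
  intro h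
  rw [h] at h3
  simp at h3

theorem covOn_all {Y : Type} [MetricSpace Y] {s : ℕ → Y} (hs : DenseRange s) {n : ℕ}
    (hY : CovDimLE Y n) : CovOn (range (e0 s) ∪ KK s n) n := by
  have hc : IsClosed {e : EE | e.2 = 0} := isClosed_eq continuous_snd continuous_const
  refine CovOn.sum_closed hc ?_ ?_
  · have : (range (e0 s) ∪ KK s n) ∩ {e : EE | e.2 = 0} = range (e0 s) := by
      ext e
      constructor
      · rintro ⟨h | h, h2⟩
        · exact h
        · exact absurd h2 (KK_snd_ne h)
      · rintro ⟨y, rfl⟩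
        exact ⟨Or.inl ⟨y, rfl⟩, rfl⟩
    rw [this]
    exact CovOn.range_of_covDimLE hY _ (isInducing_e0 hs)
  · intro N hN hemp
    have : (range (e0 s) ∪ KK s n) ∩ N = KK s n ∩ N := by
      ext e
      constructor
      · rintro ⟨⟨y, rfl⟩ | h, h2⟩
        · have : e0 s y ∈ (range (e0 s) ∪ KK s n) ∩ N ∩ {e : EE | e.2 = 0} :=
            ⟨⟨Or.inl ⟨y, rfl⟩, h2⟩, rfl⟩
          rw [hemp] at this
          exact this.elim
        · exact ⟨h, h2⟩
      · rintro ⟨h, h2⟩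
        exact ⟨Or.inr h, h2⟩
    rw [this]
    exact (covOn_KK s n).inter_closed hN

theorem exists_P {Y : Type} [MetricSpace Y] [CompleteSpace Y] {s : ℕ → Y} (hs : DenseRange s)
    {n : ℕ} (hY : CovDimLE Y n) (hAE : IsAbsExtensorInDim n Y) {F : ℕ → Set Y}
    (hF : ∀ j, IsZSet (F j)) :
    ∃ P : EE → Y, ContinuousOn P (range (e0 s) ∪ KK s n) ∧ (∀ y, P (e0 s y) = y) ∧
      ∀ e ∈ KK s n, ∀ j, P e ∉ F j := by
  classical
  let Z : Set EE := range (e0 s) ∪ KK s n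
  let := TopologicalSpace.metrizableSpaceMetric Z
  have hZ : CovDimLE Z n := (covOn_all hs hY).covDimLE
  let Y0 : Set Z := {z | z.1.2 = 0}
  have hY0 : IsClosed Y0 := isClosed_eq (by fun_prop) continuous_const
  have hch : ∀ z : Y0, ∃ y, e0 s y = z.1.1 := by
    rintro ⟨⟨e, he | he⟩, h⟩
    · exact he
    · exact absurd h (KK_snd_ne he)
  choose f hf using hch
  have hfc : Continuous f := by
    rw [(isInducing_e0 hs).continuous_iff]
    have : e0 s ∘ f = fun z => z.1.1 := funext hf
    rw [this]
    fun_prop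
  obtain ⟨p0, hp0⟩ := hAE Z hZ Y0 hY0 ⟨f, hfc⟩
  obtain ⟨p, hp1, hp2⟩ := avoid (covDimLE_prod hZ) hAE hY0
    (κ := {σ : Finset ℕ // σ.card ≤ n + 1}) (C := fun σ => {z : Z | z.1 ∈ face s σ.1})
    (fun σ => by
      rw [Subtype.isCompact_iff]
      convert isCompact_face s σ.1 using 1
      ext e
      constructor
      · rintro ⟨z, hz, rfl⟩; exact hz
      · intro he; exact ⟨⟨e, Or.inr ⟨σ.1, σ.2, he⟩⟩, he, rfl⟩)
    (fun σ => by
      rw [disjoint_left]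
      intro z hz hz2
      exact KK_snd_ne (s := s) (n := n) ⟨σ.1, σ.2, hz⟩ hz2) hF p0
  have hPe : ∀ e (h : e ∈ Z), (if h : e ∈ Z then p ⟨e, h⟩ else s 0) = p ⟨e, h⟩ := fun e h =>
    dif_pos h
  refine ⟨fun e => if h : e ∈ Z then p ⟨e, h⟩ else s 0, ?_, ?_, ?_⟩
  · rw [continuousOn_iff_continuous_domRestrict]
    have hpc : Continuous (fun z : Z => p z) := p.continuous
    refine hpc.congr fun z => ?_
    exact (hPe z.1 z.2).symm
  · intro y
    have hy : e0 s y ∈ Z := Or.inl ⟨y, rfl⟩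
    refine (hPe _ hy).trans ?_
    have hy0 : (⟨e0 s y, hy⟩ : Z) ∈ Y0 := rfl
    rw [hp1 _ hy0, hp0 ⟨_, hy0⟩]
    have := hf ⟨_, hy0⟩
    have hinj : Function.Injective (e0 s) := (isInducing_e0 hs).injective
    exact hinj this
  · rintro e he j
    have hz : e ∈ Z := Or.inr he
    have heq := hPe e hz
    obtain ⟨σ, hσ, heσ⟩ := he
    have := hp2 ⟨σ, hσ⟩ j ⟨e, hz⟩ heσ
    rw [← heq] at this
    exact this

theorem local_P {Y : Type} [MetricSpace Y] {s : ℕ → Y} {n : ℕ} {P : EE → Y}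
    (hP : ContinuousOn P (range (e0 s) ∪ KK s n)) (hP0 : ∀ y, P (e0 s y) = y)
    {y : Y} {u : Set Y} (hu : IsOpen u) (hy : y ∈ u) :
    ∃ ρ : ℝ, 0 < ρ ∧ Metric.ball y ρ ⊆ u ∧ ∀ σ : Finset ℕ, σ.card ≤ n + 1 → ∀ e ∈ face s σ,
      (∀ i ∈ σ, dist (s i) y < ρ ∧ 1 / ρ < i) → P e ∈ u := by
  obtain ⟨ρ0, hρ0, hb⟩ := Metric.isOpen_iff.1 hu y hy
  by_contra hcon
  push Not at hcon
  have hk : ∀ k : ℕ, ∃ σ : Finset ℕ, σ.card ≤ n + 1 ∧ ∃ e ∈ face s σ,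
      (∀ i ∈ σ, dist (s i) y < min ρ0 (1 / ((k : ℝ) + 1)) ∧
        1 / (min ρ0 (1 / ((k : ℝ) + 1))) < i) ∧ P e ∉ u := by
    intro k
    exact hcon (min ρ0 (1 / ((k : ℝ) + 1))) (by positivity)
      ((Metric.ball_subset_ball (min_le_left _ _)).trans hb)
  choose σ hσ e he h1 h2 using hk
  have hlim : Filter.Tendsto e Filter.atTop (𝓝 (e0 s y)) := by
    rw [Prod.tendsto_iff]
    constructor
    · rw [tendsto_pi_nhds]
      intro j
      rw [tendsto_iff_dist_tendsto_zero]
      refine squeeze_zero (fun _ => dist_nonneg) (fun k => ?_)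
        tendsto_one_div_add_atTop_nhds_zero_nat
      obtain ⟨b1, b2, b3, b4⟩ := he k
      have e1 : (e k).1 j - dist y (s j) =
          ∑ i ∈ σ k, (e k).2 i * (dist (s i) (s j) - dist y (s j)) := by
        simp only [mul_sub, Finset.sum_sub_distrib]
        rw [← Finset.sum_mul, b3, b4, one_mul]
      show dist ((e k).1 j) (dist y (s j)) ≤ _
      rw [Real.dist_eq, e1]
      refine (Finset.abs_sum_le_sum_abs _ _).trans ?_
      calc ∑ i ∈ σ k, |(e k).2 i * (dist (s i) (s j) - dist y (s j))|
          ≤ ∑ i ∈ σ k, (e k).2 i * (1 / ((k : ℝ) + 1)) := by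
            refine Finset.sum_le_sum fun i hi => ?_
            rw [abs_mul, abs_of_nonneg (b1 i)]
            refine mul_le_mul_of_nonneg_left ?_ (b1 i)
            refine (abs_dist_sub_le _ _ _).trans ?_
            exact (h1 k i hi).1.le.trans (min_le_right _ _)
        _ = 1 / ((k : ℝ) + 1) := by rw [← Finset.sum_mul, b3, one_mul]
    · rw [tendsto_pi_nhds]
      intro i
      refine tendsto_const_nhds.congr' ?_
      filter_upwards [Filter.eventually_ge_atTop i] with k hki
      show (0 : ℝ) = (e k).2 i
      refine ((he k).2.1 i fun hi => ?_).symm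
      have g1 := (h1 k i hi).2
      have hkp : (0 : ℝ) < (k : ℝ) + 1 := by positivity
      have g2 : (k : ℝ) + 1 ≤ 1 / (min ρ0 (1 / ((k : ℝ) + 1))) := by
        rw [le_div_iff₀ (by positivity)]
        calc ((k : ℝ) + 1) * min ρ0 (1 / ((k : ℝ) + 1)) ≤ ((k : ℝ) + 1) * (1 / ((k : ℝ) + 1)) :=
              mul_le_mul_of_nonneg_left (min_le_right _ _) hkp.le
          _ = 1 := by field_simp
      have g3 : (i : ℝ) ≤ k := by exact_mod_cast hki
      linarith
  have hlim2 : Filter.Tendsto e Filter.atTop (𝓝[range (e0 s) ∪ KK s n] (e0 s y)) :=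
    tendsto_nhdsWithin_iff.2 ⟨hlim, Filter.Eventually.of_forall fun k => Or.inr ⟨σ k, hσ k, he k⟩⟩
  have hPl := (hP (e0 s y) (Or.inl ⟨y, rfl⟩)).tendsto.comp hlim2
  rw [hP0] at hPl
  obtain ⟨k, hk⟩ := (hPl.eventually (hu.mem_nhds hy)).exists
  exact h2 k hk

theorem approx_P {Y : Type} [MetricSpace Y] {s : ℕ → Y} {n : ℕ} {P : EE → Y}
    (hs : ∀ v : Set Y, IsOpen v → v.Nonempty → ∀ N : ℕ, ∃ i, N ≤ i ∧ s i ∈ v)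
    (hY : CovDimLE Y n)
    (hP : ContinuousOn P (range (e0 s) ∪ KK s n)) (hP0 : ∀ y, P (e0 s y) = y)
    (𝒰 : Set (Set Y)) (h𝒰 : IsOpenCover 𝒰) :
    ∃ q : Y → EE, Continuous q ∧ (∀ x, q x ∈ KK s n) ∧ UClose 𝒰 (fun x => P (q x)) id := by
  classical
  have hu : ∀ y : Y, ∃ u ∈ 𝒰, y ∈ u := fun y => mem_sUnion.1 (h𝒰.2 ▸ mem_univ y)
  choose u hu1 hu2 using hu
  choose ρ hρ hρb hρ2 using fun y => local_P hP hP0 (h𝒰.1 _ (hu1 y)) (hu2 y)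
  obtain ⟨𝒱, ⟨v1, v2⟩, v3, v4⟩ := hY (range fun c => Metric.ball c (ρ c / 3))
    ⟨by rintro _ ⟨y, rfl⟩; exact Metric.isOpen_ball, by
      refine eq_univ_of_forall fun y => ?_
      exact mem_sUnion.2 ⟨_, mem_range_self y, Metric.mem_ball_self (by have := hρ y; positivity)⟩⟩
  let VV : Type := {v : Set Y // v ∈ 𝒱 ∧ v.Nonempty}
  have hc : ∀ v : VV, ∃ c, v.1 ⊆ Metric.ball c (ρ c / 3) := by
    intro v
    obtain ⟨_, ⟨c, rfl⟩, h⟩ := v3 v.1 v.2.1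
    exact ⟨c, h⟩
  choose c hc using hc
  have hi : ∀ v : VV, ∃ i : ℕ, 1 / (ρ (c v) / 3) < i ∧ s i ∈ v.1 := by
    intro v
    obtain ⟨N, hN⟩ := exists_nat_gt (1 / (ρ (c v) / 3))
    obtain ⟨i, h1, h2⟩ := hs v.1 (v1 _ v.2.1) v.2.2 N
    exact ⟨i, hN.trans_le (by exact_mod_cast h1), h2⟩
  choose iv hi1 hi2 using hi
  let O : ℕ → Set Y := fun i => ⋃ v : VV, ⋃ _ : iv v = i, v.1
  have hO : ∀ i, IsOpen (O i) := fun i =>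
    isOpen_iUnion fun v => isOpen_iUnion fun _ => v1 _ v.2.1
  obtain ⟨f, hf⟩ := PartitionOfUnity.exists_isSubordinate (isClosed_univ (X := Y)) O hO (by
    intro x _
    obtain ⟨v, hv, hx⟩ := mem_sUnion.1 (v2 ▸ mem_univ x)
    exact mem_iUnion.2 ⟨iv ⟨v, hv, x, hx⟩, mem_iUnion.2 ⟨⟨v, hv, x, hx⟩, mem_iUnion.2 ⟨rfl, hx⟩⟩⟩)
  have hfin : ∀ x, {i | f i x ≠ 0}.Finite := fun x => f.locallyFinite.point_finite x
  let σ : Y → Finset ℕ := fun x => (hfin x).toFinset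
  have hσ : ∀ x i, i ∈ σ x ↔ f i x ≠ 0 := fun x i => (hfin x).mem_toFinset
  let q : Y → EE := fun x => (fun j => ∑ᶠ i, f i x * dist (s i) (s j), fun i => f i x)
  have hqc : Continuous q := by
    refine Continuous.prodMk ?_ ?_
    · refine continuous_pi fun j => continuous_finsum (fun i => by fun_prop) ?_
      refine f.locallyFinite.subset fun i x hx => ?_
      intro h0
      exact hx (by show f i x * _ = 0; rw [h0, zero_mul])
    · exact continuous_pi fun i => by fun_prop
  have hsum : ∀ x, ∑ i ∈ σ x, f i x = 1 := by
    intro x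
    rw [← f.sum_eq_one (mem_univ x)]
    refine (finsum_eq_sum_of_support_subset _ fun i hi => ?_).symm
    exact (hσ x i).2 hi
  have hface : ∀ x, q x ∈ face s (σ x) := by
    intro x
    refine ⟨fun i => f.nonneg i x, fun i hi => ?_, hsum x, fun j => ?_⟩
    · by_contra h
      exact hi ((hσ x i).2 h)
    · refine finsum_eq_sum_of_support_subset _ fun i hi => ?_
      refine (hσ x i).2 fun h0 => hi ?_
      show f i x * _ = 0
      rw [h0, zero_mul]
  have hw : ∀ x, ∀ i ∈ σ x, ∃ v : VV, iv v = i ∧ x ∈ v.1 := by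
    intro x i hi
    have : x ∈ O i := hf i (subset_tsupport _ ((hσ x i).1 hi))
    obtain ⟨v, hv⟩ := mem_iUnion.1 this
    obtain ⟨h, hx⟩ := mem_iUnion.1 hv
    exact ⟨v, h, hx⟩
  have hmain : ∀ x, (σ x).card ≤ n + 1 ∧ ∃ u ∈ 𝒰, P (q x) ∈ u ∧ x ∈ u := by
    intro x
    have hne : (σ x).Nonempty := by
      by_contra h
      have := hsum x
      rw [Finset.not_nonempty_iff_eq_empty.1 h, Finset.sum_empty] at this
      exact zero_ne_one this
    obtain ⟨i1, hi1'⟩ := hne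
    have hVV : Nonempty VV := ⟨(hw x i1 hi1').choose⟩
    have hwx := hw x
    choose! w hw1 hw2 using hwx
    have hcard : (σ x).card ≤ n + 1 := by
      refine le_trans ?_ (v4 x).2
      rw [← Set.ncard_coe_finset]
      refine Set.ncard_le_ncard_of_injOn (fun i => (w i).1) (fun i hi => ?_) ?_ (v4 x).1
      · exact ⟨(w i).2.1, hw2 i hi⟩
      · intro i hi k hk h
        have : w i = w k := Subtype.ext h
        rw [← hw1 i hi, ← hw1 k hk, this]
    refine ⟨hcard, ?_⟩
    obtain ⟨k, hk, hmax⟩ := Finset.exists_max_image (σ x) (fun i => ρ (c (w i))) ⟨i1, hi1'⟩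
    refine ⟨u (c (w k)), hu1 _, ?_, ?_⟩
    · refine hρ2 (c (w k)) (σ x) hcard (q x) (hface x) fun i hi => ?_
      have hle : ρ (c (w i)) ≤ ρ (c (w k)) := hmax i hi
      have p1 := hρ (c (w i))
      have p2 := hρ (c (w k))
      constructor
      · have d1 : s i ∈ (w i).1 := by
          have := hi2 (w i)
          rwa [hw1 i hi] at this
        have d1 := hc _ d1
        have d2 := hc _ (hw2 i hi)
        have d3 := hc _ (hw2 k hk)
        rw [Metric.mem_ball] at d1 d2 d3
        have t1 := dist_triangle_right (s i) x (c (w i))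
        have t2 := dist_triangle (s i) x (c (w k))
        linarith
      · have := hi1 (w i)
        rw [hw1 i hi] at this
        refine lt_of_le_of_lt ?_ this
        exact one_div_le_one_div_of_le (by positivity) (by linarith)
    · apply hρb
      have d3 := hc _ (hw2 k hk)
      refine Metric.ball_subset_ball ?_ d3
      have := hρ (c (w k))
      linarith
  exact ⟨q, hqc, fun x => ⟨σ x, (hmain x).1, hface x⟩, fun x => (hmain x).2⟩

theorem final_aux (n : ℕ) (Y : Type) [TopologicalSpace Y]
    (hY : IsNobeling n Y) (X : Set Y) (hσ : IsSigmaZSet Xᶜ)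
    (A : Set Y) (hA : IsClosed A) (hAX : A ∩ X = ∅) :
    IsZSet A := by
  refine ⟨hA, fun 𝒰 h𝒰 => ?_⟩
  rcases isEmpty_or_nonempty Y with hemp | hne
  · exact ⟨ContinuousMap.id Y, fun a => (hemp.false a).elim,
      eq_empty_of_forall_notMem fun a => (hemp.false a).elim⟩
  obtain ⟨hpol, ⟨hdim, -⟩, hAE, -⟩ := hY
  let := TopologicalSpace.upgradeIsCompletelyMetrizable Y
  obtain ⟨F, hF, hXF⟩ := hσ
  let s : ℕ → Y := fun i => TopologicalSpace.denseSeq Y (Nat.unpair i).1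
  have hs : ∀ v : Set Y, IsOpen v → v.Nonempty → ∀ N : ℕ, ∃ i, N ≤ i ∧ s i ∈ v := by
    intro v hv hvn N
    obtain ⟨m, hm⟩ := (TopologicalSpace.denseRange_denseSeq Y).exists_mem_open hv hvn
    refine ⟨Nat.pair m N, Nat.right_le_pair m N, ?_⟩
    simp only [s, Nat.unpair_pair]
    exact hm
  have hsd : DenseRange s := by
    rw [DenseRange, dense_iff_inter_open]
    intro v hv hvn
    obtain ⟨i, -, hi⟩ := hs v hv hvn 0
    exact ⟨s i, hi, mem_range_self i⟩
  obtain ⟨P, hP, hP0, hPF⟩ := exists_P hsd hdim hAE hF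
  obtain ⟨q, hq, hqK, hclose⟩ := approx_P hs hdim hP hP0 𝒰 h𝒰
  refine ⟨⟨fun x => P (q x), hP.comp_continuous hq fun x => Or.inr (hqK x)⟩, hclose, ?_⟩
  refine eq_empty_of_forall_notMem ?_
  rintro _ ⟨⟨x, rfl⟩, hx⟩
  have h1 : P (q x) ∈ Xᶜ := by
    intro h2
    have : P (q x) ∈ A ∩ X := ⟨hx, h2⟩
    rw [hAX] at this
    exact this
  rw [hXF] at h1
  obtain ⟨j, hj⟩ := mem_iUnion.1 h1
  exact hPF _ (hqK x) j hj

/-- in an `n`-dimensional Nöbeling space `Y` with `Y \ X` a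
`σ-Z`-set, every closed subset of `Y` disjoint from `X` is a `Z`-set in `Y`. -/
theorem closed_disjoint_from_X_is_Zset (n : ℕ) (Y : Type) [TopologicalSpace Y]
    (hY : IsNobeling n Y) (X : Set Y) (hσ : IsSigmaZSet Xᶜ)
    (A : Set Y) (hA : IsClosed A) (hAX : A ∩ X = ∅) :
    IsZSet A :=
  final_aux n Y hY X hσ A hA hAX

end NobelingPaper
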